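/- Let α, β ∈ (0,1) be irrational. The two-sided Sturmian subshifts (Λ_α, σ_α) and (Λ_β, σ_β) are orbit equivalent if and only if α = β or α = 1 − β. -/

import Mathlib

noncomputable section

open Set

/-! ### Sturmian sequences and subshifts -/

/-- The Sturmian coding of a real number `t`: `false` (the symbol `0`) if the fractional
part of `t` lies in `[0, 1 - α)`, and `true` (the symbol `1`) if it lies in `[1 - α, 1)`. -/
def sturmianCode (α t : ℝ) : Bool := decide (1 - α ≤ Int.fract t)

/-- The one-sided Sturmian sequence with parameter `α` and starting point `t`,
i.e. `i ↦ I_α (R_α^i t)`. -/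
def sturmianSeqN (α t : ℝ) : ℕ → Bool := fun i => sturmianCode α (t + i * α)

/-- The one-sided Sturmian subshift `X_α`. -/
def sturmianN (α : ℝ) : Set (ℕ → Bool) := closure {x | ∃ t : ℝ, x = sturmianSeqN α t}

/-- The two-sided Sturmian sequence with parameter `α` and starting point `t`. -/
def sturmianSeqZ (α t : ℝ) : ℤ → Bool := fun i => sturmianCode α (t + i * α)

/-- The two-sided Sturmian subshift `Λ_α`. -/
def sturmianZ (α : ℝ) : Set (ℤ → Bool) := closure {x | ∃ t : ℝ, x = sturmianSeqZ α t}

/-- The shift on one-sided sequences. -/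
def shiftN {A : Type*} (x : ℕ → A) : ℕ → A := fun i => x (i + 1)

/-- The shift on two-sided sequences. -/
def shiftZ {A : Type*} (x : ℤ → A) : ℤ → A := fun i => x (i + 1)

lemma continuous_shiftN {A : Type*} [TopologicalSpace A] :
    Continuous (shiftN (A := A)) := continuous_pi fun i => continuous_apply (i + 1)

lemma continuous_shiftZ {A : Type*} [TopologicalSpace A] :
    Continuous (shiftZ (A := A)) := continuous_pi fun i => continuous_apply (i + 1)

lemma sturmianN_shift_mem {α : ℝ} {x : ℕ → Bool} (hx : x ∈ sturmianN α) :
    shiftN x ∈ sturmianN α := by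
  have h : MapsTo shiftN {x : ℕ → Bool | ∃ t : ℝ, x = sturmianSeqN α t}
      {x : ℕ → Bool | ∃ t : ℝ, x = sturmianSeqN α t} := by
    rintro x ⟨t, rfl⟩
    refine ⟨t + α, ?_⟩
    funext i
    show sturmianCode α (t + (↑(i + 1) : ℝ) * α) = sturmianCode α (t + α + (i : ℝ) * α)
    congr 1
    push_cast
    ring
  exact h.closure continuous_shiftN hx

lemma sturmianZ_shift_mem {α : ℝ} {x : ℤ → Bool} (hx : x ∈ sturmianZ α) :
    shiftZ x ∈ sturmianZ α := by
  have h : MapsTo shiftZ {x : ℤ → Bool | ∃ t : ℝ, x = sturmianSeqZ α t}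
      {x : ℤ → Bool | ∃ t : ℝ, x = sturmianSeqZ α t} := by
    rintro x ⟨t, rfl⟩
    refine ⟨t + α, ?_⟩
    funext i
    show sturmianCode α (t + (↑(i + 1) : ℝ) * α) = sturmianCode α (t + α + (i : ℝ) * α)
    congr 1
    push_cast
    ring
  exact h.closure continuous_shiftZ hx

/-- The shift map `σ_α : X_α → X_α` of the one-sided Sturmian subshift. -/
def sturmianShiftN (α : ℝ) (x : ↥(sturmianN α)) : ↥(sturmianN α) :=
  ⟨shiftN x.1, sturmianN_shift_mem x.2⟩

/-- The shift map `σ_α : Λ_α → Λ_α` of the two-sided Sturmian subshift. -/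
def sturmianShiftZ (α : ℝ) (x : ↥(sturmianZ α)) : ↥(sturmianZ α) :=
  ⟨shiftZ x.1, sturmianZ_shift_mem x.2⟩

/-- The branch point `ω_α` of the one-sided Sturmian subshift (corresponding to `t = α`). -/
def sturmianBranch (α : ℝ) : ℕ → Bool := sturmianSeqN α α

/-- The orbit `orb_α(x) = ⋃_{k,l} σ_α^{-l}(σ_α^k(x))` of a point of `X_α`. -/
def sturmianOrbN (α : ℝ) (x : ℕ → Bool) : Set (ℕ → Bool) :=
  {y | y ∈ sturmianN α ∧ ∃ k l : ℕ, shiftN^[l] y = shiftN^[k] x}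

/-- The forward orbit `orb⁺_α(x) = {σ_α^k(x) : k ∈ ℕ}`. -/
def sturmianOrbPlus (α : ℝ) (x : ℕ → Bool) : Set (ℕ → Bool) :=
  {y | ∃ k : ℕ, y = shiftN^[k] x}

/-- The orbit `{σ^n(x) : n ∈ ℤ}` of a two-sided sequence under the shift:
`σ^n(x) = (i ↦ x (i + n))`. -/
def orbitZ {A : Type*} (x : ℤ → A) : Set (ℤ → A) := {y | ∃ n : ℤ, y = fun i => x (i + n)}

/-- Equivalence of irrationals: `α ∼ β` iff `β = (aα+b)/(cα+d)` with `ad - bc = ±1`. -/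
def IrrationalEquiv (α β : ℝ) : Prop :=
  ∃ a b c d : ℤ, (a * d - b * c = 1 ∨ a * d - b * c = -1) ∧
    β = ((a : ℝ) * α + b) / ((c : ℝ) * α + d)

/-- The subgroup `ℤ + αℤ = {m + nα : m, n ∈ ℤ}` of `ℝ`, as an ordered abelian group with
the order inherited from `ℝ`. -/
def ZplusAZ (α : ℝ) : AddSubgroup ℝ where
  carrier := {x | ∃ m n : ℤ, x = (m : ℝ) + n * α}
  add_mem' := by
    rintro x y ⟨m, n, rfl⟩ ⟨m', n', rfl⟩
    exact ⟨m + m', n + n', by push_cast; ring⟩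
  zero_mem' := ⟨0, 0, by norm_num⟩
  neg_mem' := by
    rintro x ⟨m, n, rfl⟩
    exact ⟨-m, -n, by push_cast; ring⟩

lemma one_mem_ZplusAZ (α : ℝ) : (1 : ℝ) ∈ ZplusAZ α := ⟨1, 0, by norm_num⟩

/-! ### Suspension and flow -/

/-- The relation `(x, s+1) ∼ (σ_α x, s)` generating the suspension of `(Λ_α, σ_α)`. -/
def suspRel (α : ℝ) (p q : ↥(sturmianZ α) × ℝ) : Prop :=
  ∃ (x : ↥(sturmianZ α)) (s : ℝ), p = (x, s + 1) ∧ q = (sturmianShiftZ α x, s)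

/-- The suspension (mapping torus) of the two-sided Sturmian subshift `(Λ_α, σ_α)`:
the quotient of `Λ_α × ℝ` by the equivalence relation generated by `(x,s+1) ∼ (σ_α x, s)`. -/
def Suspension (α : ℝ) : Type := Quot (suspRel α)

instance (α : ℝ) : TopologicalSpace (Suspension α) := by
  unfold Suspension; infer_instance

/-- The flow `φ_{s'}[x,s] = [x, s + s']` on the suspension. -/
def suspFlow (α : ℝ) (s' : ℝ) : Suspension α → Suspension α :=
  Quot.map (fun p => (p.1, p.2 + s'))
    (by
      rintro p q ⟨x, s, rfl, rfl⟩
      exact ⟨x, s + s', by show (x, s + 1 + s') = (x, s + s' + 1); rw [add_right_comm s 1 s'], rfl⟩)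

/-- Flow equivalence of two Sturmian subshifts: a homeomorphism of the suspensions mapping
each flow orbit onto a flow orbit, preserving the forward direction of the flow. -/
def SturmianFlowEquiv (α β : ℝ) : Prop :=
  ∃ h : Suspension α ≃ₜ Suspension β, ∀ u : Suspension α, ∃ c : ℝ → ℝ,
    StrictMono c ∧ Function.Surjective c ∧
      ∀ s : ℝ, h (suspFlow α s u) = suspFlow β (c s) (h u)

/-! ### Words and pasts -/

/-- Prepend a letter to a one-sided sequence. -/
def consSeq {A : Type*} (a : A) (x : ℕ → A) : ℕ → A := fun i => if i = 0 then a else x (i - 1)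

/-- Prepend a finite word (a list) to a one-sided sequence: `μx`. -/
def wordCat {A : Type*} (μ : List A) (x : ℕ → A) : ℕ → A := μ.foldr consSeq x

/-- The set `P_l(x)` of `l`-pasts of `x` relative to a subshift `X`. -/
def past {A : Type*} (X : Set (ℕ → A)) (l : ℕ) (x : ℕ → A) : Set (List A) :=
  {μ | μ.length = l ∧ wordCat μ x ∈ X}

/-- `x` is isolated in `l`-past equivalence in `X`. -/
def IsolatedInPast {A : Type*} (X : Set (ℕ → A)) (l : ℕ) (x : ℕ → A) : Prop :=
  ∀ y ∈ X, past X l y = past X l x → y = x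


lemma shiftN_consSeq {A : Type*} (a : A) (x : ℕ → A) : shiftN (consSeq a x) = x := by
  funext i; simp [shiftN, consSeq]

lemma consSeq_shiftN {A : Type*} (x : ℕ → A) : consSeq (x 0) (shiftN x) = x := by
  funext i; cases i <;> simp [consSeq, shiftN]

lemma shiftN_iterate_apply {A : Type*} (x : ℕ → A) (k i : ℕ) : shiftN^[k] x i = x (i + k) := by
  induction k generalizing x i with
  | zero => rfl
  | succ k ih =>
    rw [Function.iterate_succ_apply, ih (shiftN x) i]
    show x (i + k + 1) = x (i + (k + 1))
    ring_nf

lemma shiftN_iterate_wordCat {A : Type*} (μ : List A) (x : ℕ → A) :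
    shiftN^[μ.length] (wordCat μ x) = x := by
  induction μ with
  | nil => rfl
  | cons a μ ih =>
    show shiftN^[μ.length + 1] (consSeq a (wordCat μ x)) = x
    rw [Function.iterate_succ_apply, shiftN_consSeq, ih]

lemma wordCat_append {A : Type*} (μ ν : List A) (x : ℕ → A) :
    wordCat (μ ++ ν) x = wordCat μ (wordCat ν x) := by
  simp [wordCat, List.foldr_append]

lemma shiftN_mem_of_image {A : Type*} {X : Set (ℕ → A)} (hX : shiftN '' X = X)
    {x : ℕ → A} (hx : x ∈ X) : shiftN x ∈ X := by
  rw [← hX]; exact ⟨x, hx, rfl⟩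

lemma shiftN_iterate_mem_of_image {A : Type*} {X : Set (ℕ → A)} (hX : shiftN '' X = X)
    {x : ℕ → A} (hx : x ∈ X) (k : ℕ) : shiftN^[k] x ∈ X := by
  induction k generalizing x with
  | zero => exact hx
  | succ k ih =>
    rw [Function.iterate_succ_apply]
    exact ih (shiftN_mem_of_image hX hx)

lemma exists_word_extension {A : Type*} {X : Set (ℕ → A)} (hX : shiftN '' X = X)
    {z : ℕ → A} (hz : z ∈ X) (d : ℕ) : ∃ ν : List A, ν.length = d ∧ wordCat ν z ∈ X := by
  induction d with
  | zero => exact ⟨[], rfl, hz⟩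
  | succ d ih =>
    obtain ⟨ν, hlen, hν⟩ := ih
    have : wordCat ν z ∈ shiftN '' X := by rw [hX]; exact hν
    obtain ⟨w, hw, hweq⟩ := this
    refine ⟨w 0 :: ν, by simp [hlen], ?_⟩
    show consSeq (w 0) (wordCat ν z) ∈ X
    rw [← hweq, consSeq_shiftN]
    exact hw

lemma past_mono {A : Type*} {X : Set (ℕ → A)} (hX : shiftN '' X = X) {m l : ℕ} (hml : m ≤ l)
    {z z' : ℕ → A} (h : past X l z = past X l z') : past X m z = past X m z' := by
  have key : ∀ w w' : ℕ → A, past X l w ⊆ past X l w' → past X m w ⊆ past X m w' := by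
    intro w w' hsub μ hμ
    obtain ⟨hlen, hmem⟩ := hμ
    obtain ⟨ν, hνlen, hνmem⟩ := exists_word_extension hX hmem (l - m)
    rw [← wordCat_append] at hνmem
    have hin : ν ++ μ ∈ past X l w := ⟨by simp [hνlen, hlen]; omega, hνmem⟩
    have hout := hsub hin
    obtain ⟨-, hmem'⟩ := hout
    rw [wordCat_append] at hmem'
    have := shiftN_iterate_mem_of_image hX hmem' ν.length
    rw [shiftN_iterate_wordCat] at this
    exact ⟨hlen, this⟩
  exact subset_antisymm (key z z' h.subset) (key z' z h.symm.subset)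

/-- prefix word of length `d` -/
def prefixWord {A : Type*} (x : ℕ → A) (d : ℕ) : List A := (List.range d).map x

lemma wordCat_prefixWord {A : Type*} (x : ℕ → A) (d : ℕ) :
    wordCat (prefixWord x d) (shiftN^[d] x) = x := by
  induction d generalizing x with
  | zero => rfl
  | succ d ih =>
    have h1 : prefixWord x (d + 1) = x 0 :: prefixWord (shiftN x) d := by
      show (List.range (d+1)).map x = _
      rw [List.range_succ_eq_map, List.map_cons, List.map_map]
      rfl
    rw [h1, Function.iterate_succ_apply]
    show consSeq (x 0) (wordCat (prefixWord (shiftN x) d) (shiftN^[d] (shiftN x))) = x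
    rw [ih (shiftN x), consSeq_shiftN]

lemma prefixWord_length {A : Type*} (x : ℕ → A) (d : ℕ) : (prefixWord x d).length = d := by
  simp [prefixWord]

lemma past_wordCat {A : Type*} {X : Set (ℕ → A)} (τ : List A) (z : ℕ → A) (m : ℕ) (μ : List A) :
    μ ∈ past X m (wordCat τ z) ↔ μ ++ τ ∈ past X (m + τ.length) z := by
  constructor
  · rintro ⟨hlen, hmem⟩
    exact ⟨by simp [hlen], by rwa [wordCat_append]⟩
  · rintro ⟨hlen, hmem⟩
    rw [wordCat_append] at hmem
    refine ⟨?_, hmem⟩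
    simp at hlen; omega

/-- Monotonicity of `∼_{k,l}` under the order `⪯`. -/
lemma sim_mono {A : Type*} {X : Set (ℕ → A)} (hX : shiftN '' X = X)
    {k₁ l₁ k₂ l₂ : ℕ} (hk : k₁ ≤ k₂) (hl : l₁ - k₁ ≤ l₂ - k₂) (hkl₁ : k₁ ≤ l₁) (hkl₂ : k₂ ≤ l₂)
    {x y : ℕ → A}
    (h1 : ∀ i < k₂, x i = y i)
    (h2 : past X l₂ (shiftN^[k₂] x) = past X l₂ (shiftN^[k₂] y)) :
    (∀ i < k₁, x i = y i) ∧ past X l₁ (shiftN^[k₁] x) = past X l₁ (shiftN^[k₁] y) := by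
  refine ⟨fun i hi => h1 i (lt_of_lt_of_le hi hk), ?_⟩
  set d := k₂ - k₁ with hd
  have hx : shiftN^[k₁] x = wordCat (prefixWord (shiftN^[k₁] x) d) (shiftN^[k₂] x) := by
    have := wordCat_prefixWord (shiftN^[k₁] x) d
    rw [← Function.iterate_add_apply, show d + k₁ = k₂ by omega] at this
    exact this.symm
  have hy : shiftN^[k₁] y = wordCat (prefixWord (shiftN^[k₁] y) d) (shiftN^[k₂] y) := by
    have := wordCat_prefixWord (shiftN^[k₁] y) d
    rw [← Function.iterate_add_apply, show d + k₁ = k₂ by omega] at this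
    exact this.symm
  have hτ : prefixWord (shiftN^[k₁] x) d = prefixWord (shiftN^[k₁] y) d := by
    unfold prefixWord
    refine List.map_congr_left ?_
    intro j hj
    rw [List.mem_range] at hj
    rw [shiftN_iterate_apply, shiftN_iterate_apply]
    exact h1 (j + k₁) (by omega)
  have hpast : past X (l₁ + d) (shiftN^[k₂] x) = past X (l₁ + d) (shiftN^[k₂] y) :=
    past_mono hX (by omega) h2
  ext μ
  rw [hx, hy, ← hτ, past_wordCat, past_wordCat, prefixWord_length, hpast]

/-- The Sturmian subshift is invariant: `σ(X_α) = X_α`. -/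
lemma sturmianN_shift_image (α : ℝ) : shiftN '' sturmianN α = sturmianN α := by
  apply subset_antisymm
  · rintro y ⟨x, hx, rfl⟩
    exact sturmianN_shift_mem hx
  · have hcompact : IsCompact (sturmianN α) := isClosed_closure.isCompact
    have hcl : IsClosed (shiftN '' sturmianN α) :=
      (hcompact.image continuous_shiftN).isClosed
    have hsub : {x : ℕ → Bool | ∃ t : ℝ, x = sturmianSeqN α t} ⊆ shiftN '' sturmianN α := by
      rintro x ⟨t, rfl⟩
      refine ⟨sturmianSeqN α (t - α), subset_closure ⟨t - α, rfl⟩, ?_⟩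
      funext i
      show sturmianCode α (t - α + (↑(i + 1) : ℝ) * α) = sturmianCode α (t + (i : ℝ) * α)
      congr 1
      push_cast
      ring
    exact closure_minimal hsub hcl

/-! ### The cover of a one-sided subshift -/

/-- The equivalence relation `∼_{k,l}` on a subshift `X`:
`x ∼_{k,l} x'` iff `x_{[0,k)} = x'_{[0,k)}` and `P_l(σ^k x) = P_l(σ^k x')`. -/
def coverSetoid {A : Type*} (X : Set (ℕ → A)) (k l : ℕ) : Setoid ↥X where
  r x y := (∀ i < k, x.1 i = y.1 i) ∧
    past X l (shiftN^[k] x.1) = past X l (shiftN^[k] y.1)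
  iseqv := ⟨fun _ => ⟨fun _ _ => rfl, rfl⟩,
    fun h => ⟨fun i hi => (h.1 i hi).symm, h.2.symm⟩,
    fun h h' => ⟨fun i hi => (h.1 i hi).trans (h'.1 i hi), h.2.trans h'.2⟩⟩

/-- The index set `I = {(k,l) ∈ ℕ × ℕ : k ≤ l}`. -/
def CoverIdx : Type := {p : ℕ × ℕ // p.1 ≤ p.2}

/-- The partial order `⪯` on the index set: `(k₁,l₁) ⪯ (k₂,l₂)` iff `k₁ ≤ k₂` and
`l₁ - k₁ ≤ l₂ - k₂`. -/
def CoverIdx.le (p q : CoverIdx) : Prop :=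
  p.1.1 ≤ q.1.1 ∧ p.1.2 - p.1.1 ≤ q.1.2 - q.1.1

/-- The cover `X̃` of a one-sided subshift `X`: the projective limit of the finite
quotients `X/∼_{k,l}` over the directed set `I`, realised as the set of coherent families
of equivalence classes.  A family is coherent if any representative at an index `q` is also
a representative at every index `p ⪯ q`. -/
def SubshiftCover {A : Type*} (X : Set (ℕ → A)) : Type _ :=
  {f : (p : CoverIdx) → Quotient (coverSetoid X p.1.1 p.1.2) //
    ∀ p q : CoverIdx, CoverIdx.le p q → ∀ x : ↥X,
      f q = Quotient.mk (coverSetoid X q.1.1 q.1.2) x →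
      f p = Quotient.mk (coverSetoid X p.1.1 p.1.2) x}

instance {A : Type*} [TopologicalSpace A] (X : Set (ℕ → A)) :
    TopologicalSpace (SubshiftCover X) := by
  unfold SubshiftCover; infer_instance

/-- The factor map `π : X̃ → X` (with values in the ambient space `A^ℕ`): the `n`-th letter
of `π(xt)` is the `n`-th letter of any `(n+1, n+1)`-representative of `xt`. -/
def coverProj {A : Type*} {X : Set (ℕ → A)} (f : SubshiftCover X) : ℕ → A := fun n =>
  Quotient.lift (fun x : ↥X => x.1 n)
    (by intro a b h; obtain ⟨h1, -⟩ := h; exact h1 n (Nat.lt_succ_self n))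
    (f.1 ⟨(n + 1, n + 1), le_refl _⟩)

/-- The shift `σ̃ : X̃ → X̃` induced on the cover: the `(k,l)`-coordinate of `σ̃(xt)` is the
class of `σ(x)` for a `(k+1, l+1)`-representative `x` of `xt`. -/
def coverShift {A : Type*} {X : Set (ℕ → A)} (hX : shiftN '' X = X)
    (f : SubshiftCover X) : SubshiftCover X :=
  ⟨fun p => Quotient.lift
      (fun x : ↥X => Quotient.mk (coverSetoid X p.1.1 p.1.2)
        ⟨shiftN x.1, shiftN_mem_of_image hX x.2⟩)
      (by
        intro a b h
        obtain ⟨h1, h2⟩ := h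
        apply Quotient.sound
        constructor
        · intro i hi
          exact h1 (i + 1) (Nat.succ_lt_succ hi)
        · show past X p.1.2 (shiftN^[p.1.1] (shiftN a.1)) =
            past X p.1.2 (shiftN^[p.1.1] (shiftN b.1))
          rw [← Function.iterate_succ_apply, ← Function.iterate_succ_apply]
          exact past_mono hX (Nat.le_succ p.1.2) h2)
      (f.1 ⟨(p.1.1 + 1, p.1.2 + 1), Nat.succ_le_succ p.2⟩),
    by
      intro p q hpq y hy
      obtain ⟨x, hx⟩ := Quotient.exists_rep (f.1 ⟨(q.1.1 + 1, q.1.2 + 1), Nat.succ_le_succ q.2⟩)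
      have hq' : f.1 ⟨(p.1.1 + 1, p.1.2 + 1), Nat.succ_le_succ p.2⟩ =
          Quotient.mk (coverSetoid X (p.1.1 + 1) (p.1.2 + 1)) x := by
        refine f.2 _ ⟨(q.1.1 + 1, q.1.2 + 1), Nat.succ_le_succ q.2⟩ ?_ x hx.symm
        refine ⟨Nat.succ_le_succ hpq.1, ?_⟩
        show p.1.2 + 1 - (p.1.1 + 1) ≤ q.1.2 + 1 - (q.1.1 + 1)
        have := hpq.2; omega
      beta_reduce at hy ⊢
      rw [← hx] at hy
      rw [hq']
      obtain ⟨h1, h2⟩ := Quotient.exact hy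
      exact Quotient.sound (sim_mono hX hpq.1 hpq.2 p.2 q.2 h1 h2)⟩

/-- The section `ι : X → X̃`, sending `x` to the family of its own classes. -/
def coverIota {A : Type*} {X : Set (ℕ → A)} (hX : shiftN '' X = X) (x : ↥X) :
    SubshiftCover X :=
  ⟨fun p => Quotient.mk (coverSetoid X p.1.1 p.1.2) x, by
    intro p q hpq y hy
    obtain ⟨h1, h2⟩ := Quotient.exact hy
    exact Quotient.sound (sim_mono hX hpq.1 hpq.2 p.2 q.2 h1 h2)⟩


/-! ### Shift powers on two-sided Sturmian subshifts -/

open MeasureTheory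

lemma sturmianZ_shiftBy_mem {α : ℝ} (n : ℤ) {x : ℤ → Bool} (hx : x ∈ sturmianZ α) :
    (fun i => x (i + n)) ∈ sturmianZ α := by
  have h : MapsTo (fun (x : ℤ → Bool) i => x (i + n))
      {x : ℤ → Bool | ∃ t : ℝ, x = sturmianSeqZ α t}
      {x : ℤ → Bool | ∃ t : ℝ, x = sturmianSeqZ α t} := by
    rintro x ⟨t, rfl⟩
    refine ⟨t + n * α, ?_⟩
    funext i
    show sturmianCode α (t + (↑(i + n) : ℝ) * α) = sturmianCode α (t + n * α + (i : ℝ) * α)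
    congr 1
    push_cast
    ring
  exact h.closure (continuous_pi fun i => continuous_apply (i + n)) hx

lemma continuous_sturmianZ_apply (α : ℝ) (i : ℤ) :
    Continuous fun x : ↥(sturmianZ α) => x.1 i :=
  (continuous_apply i).comp continuous_subtype_val

/-- The `n`-th power of the shift, as a homeomorphism of `Λ_α`. -/
def sturmianShiftBy (α : ℝ) (n : ℤ) : ↥(sturmianZ α) ≃ₜ ↥(sturmianZ α) where
  toFun x := ⟨fun i => x.1 (i + n), sturmianZ_shiftBy_mem n x.2⟩
  invFun x := ⟨fun i => x.1 (i + -n), sturmianZ_shiftBy_mem (-n) x.2⟩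
  left_inv x := by ext i; simp
  right_inv x := by ext i; simp
  continuous_toFun := Continuous.subtype_mk
    (continuous_pi fun i => continuous_sturmianZ_apply α (i + n)) _
  continuous_invFun := Continuous.subtype_mk
    (continuous_pi fun i => continuous_sturmianZ_apply α (i + -n)) _

@[simp]
lemma sturmianShiftBy_apply {α : ℝ} (n : ℤ) (x : ↥(sturmianZ α)) (i : ℤ) :
    (sturmianShiftBy α n x).1 i = x.1 (i + n) := rfl

lemma mem_orbitZ_iff {α : ℝ} {x y : ↥(sturmianZ α)} :
    y.1 ∈ orbitZ x.1 ↔ ∃ n, y = sturmianShiftBy α n x :=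
  exists_congr fun n => (Subtype.ext_iff (a2 := sturmianShiftBy α n x)).symm

/-! ### The coding in terms of integer parts -/

lemma sturmianCode_eq_floor {α : ℝ} (hα : α ∈ Ioo (0 : ℝ) 1) (s : ℝ) :
    (if sturmianCode α s = true then 1 else 0 : ℤ) = ⌊s + α⌋ - ⌊s⌋ := by
  have h0 := Int.fract_nonneg s
  have h1 := Int.fract_lt_one s
  have hs := Int.floor_add_fract s
  obtain ⟨ha, hb⟩ := hα
  simp only [sturmianCode, decide_eq_true_eq]
  split_ifs with h
  · have : ⌊s + α⌋ = ⌊s⌋ + 1 := by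
      rw [Int.floor_eq_iff]; push_cast; constructor <;> linarith
    omega
  · have : ⌊s + α⌋ = ⌊s⌋ := by
      rw [Int.floor_eq_iff]; constructor <;> linarith
    omega

lemma sturmianCode_add_one (α s : ℝ) : sturmianCode α (s + 1) = sturmianCode α s := by
  simp [sturmianCode]

lemma sturmianCode_one_sub {α : ℝ} (hα : α ∈ Ioo (0 : ℝ) 1) (s : ℝ) :
    sturmianCode (1 - α) (s + α) = !sturmianCode α s := by
  have h1 := sturmianCode_eq_floor hα s
  have h2 := sturmianCode_eq_floor (α := 1 - α) ⟨by linarith [hα.2], by linarith [hα.1]⟩ (s + α)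
  rw [show s + α + (1 - α) = s + 1 by ring, Int.floor_add_one] at h2
  cases hc : sturmianCode α s <;> cases hd : sturmianCode (1 - α) (s + α) <;>
    simp_all; omega

lemma floor_add_of_mem_Ico {t : ℝ} (ht : t ∈ Ico (0 : ℝ) 1) (a : ℝ) :
    (⌊t + a⌋ : ℝ) = ⌊a⌋ + (Ico (1 - Int.fract a) 1).indicator 1 t := by
  have h0 := Int.fract_nonneg a
  have h1 := Int.fract_lt_one a
  have hs := Int.floor_add_fract a
  obtain ⟨ha, hb⟩ := ht
  by_cases h : 1 - Int.fract a ≤ t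
  · have : ⌊t + a⌋ = ⌊a⌋ + 1 := by
      rw [Int.floor_eq_iff]; push_cast; constructor <;> linarith
    rw [this, indicator_of_mem (mem_Ico.2 ⟨h, hb⟩)]; simp
  · have : ⌊t + a⌋ = ⌊a⌋ := by
      rw [Int.floor_eq_iff]; constructor <;> linarith
    rw [this, indicator_of_notMem (fun hh => h hh.1)]; simp

/-- Sturmian sequences are balanced: a word of length `N` contains `N α` ones up to an error
of at most `1`. -/
lemma sturmianZ_balanced {α : ℝ} (hα : α ∈ Ioo (0 : ℝ) 1) {x : ℤ → Bool}
    (hx : x ∈ sturmianZ α) (N : ℕ) :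
    |∑ i ∈ Finset.range N, (if x i = true then 1 else 0 : ℝ) - N * α| ≤ 1 := by
  have hcl : IsClosed {x : ℤ → Bool |
      |∑ i ∈ Finset.range N, (if x i = true then 1 else 0 : ℝ) - N * α| ≤ 1} := by
    have hcont (i : ℕ) : Continuous fun x : ℤ → Bool => (if x i = true then 1 else 0 : ℝ) :=
      (continuous_of_discreteTopology (f := fun b : Bool => if b = true then (1 : ℝ) else 0)).comp
        (continuous_apply (i : ℤ))
    exact isClosed_le (by fun_prop) continuous_const
  refine closure_minimal ?_ hcl hx
  rintro _ ⟨t, rfl⟩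
  have hterm (i : ℕ) : (if sturmianSeqZ α t i = true then 1 else 0 : ℝ)
      = (⌊t + (i + 1 : ℕ) * α⌋ : ℝ) - ⌊t + i * α⌋ := by
    have h := sturmianCode_eq_floor hα (t + i * α)
    rw [show t + i * α + α = t + (i + 1 : ℕ) * α by push_cast; ring] at h
    rw [← Int.cast_sub, ← h]
    simp [sturmianSeqZ]
  show |∑ i ∈ Finset.range N, (if sturmianSeqZ α t i = true then 1 else 0 : ℝ) - N * α| ≤ 1
  rw [Finset.sum_congr rfl fun i _ => hterm i,
    Finset.sum_range_sub (fun i : ℕ => (⌊t + i * α⌋ : ℝ))]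
  have h1 := Int.floor_le (t + N * α)
  have h2 := Int.lt_floor_add_one (t + N * α)
  have h3 := Int.floor_le t
  have h4 := Int.lt_floor_add_one t
  simp only [Nat.cast_zero, zero_mul, add_zero]
  rw [abs_le]
  constructor <;> linarith

/-! ### The flip homeomorphism `Λ_α ≃ Λ_{1-α}` -/

lemma sturmianZ_flip_mem {α β : ℝ} (hα : α ∈ Ioo (0 : ℝ) 1) (h : β = 1 - α) {x : ℤ → Bool}
    (hx : x ∈ sturmianZ α) : (fun i => !x (-i)) ∈ sturmianZ β := by
  subst h
  have h : MapsTo (fun (x : ℤ → Bool) i => !x (-i))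
      {x : ℤ → Bool | ∃ t : ℝ, x = sturmianSeqZ α t}
      {x : ℤ → Bool | ∃ t : ℝ, x = sturmianSeqZ (1 - α) t} := by
    rintro x ⟨t, rfl⟩
    refine ⟨t + α, ?_⟩
    funext i
    show (!sturmianCode α (t + (↑(-i) : ℝ) * α)) = sturmianCode (1 - α) (t + α + i * (1 - α))
    rw [← sturmianCode_one_sub hα,
      show t + α + i * (1 - α) = t + (↑(-i) : ℝ) * α + α + (i : ℤ) by push_cast; ring]
    simp [sturmianCode]
  refine h.closure (continuous_pi fun i => ?_) hx
  exact (continuous_of_discreteTopology (f := Bool.not)).comp (continuous_apply (-i))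

/-- Exchanging the two symbols and reversing time maps `Λ_α` onto `Λ_{1-α}`. -/
def sturmianFlip {α β : ℝ} (hα : α ∈ Ioo (0 : ℝ) 1) (hβ : β ∈ Ioo (0 : ℝ) 1) (h : α = 1 - β) :
    ↥(sturmianZ α) ≃ₜ ↥(sturmianZ β) where
  toFun x := ⟨fun i => !x.1 (-i), sturmianZ_flip_mem hα (by linarith) x.2⟩
  invFun x := ⟨fun i => !x.1 (-i), sturmianZ_flip_mem hβ h x.2⟩
  left_inv x := by ext i; simp
  right_inv x := by ext i; simp
  continuous_toFun := Continuous.subtype_mk (continuous_pi fun i =>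
    (continuous_of_discreteTopology (f := Bool.not)).comp
      (continuous_sturmianZ_apply α (-i))) _
  continuous_invFun := Continuous.subtype_mk (continuous_pi fun i =>
    (continuous_of_discreteTopology (f := Bool.not)).comp
      (continuous_sturmianZ_apply β (-i))) _

lemma sturmianFlip_shiftBy {α β : ℝ} (hα : α ∈ Ioo (0 : ℝ) 1) (hβ : β ∈ Ioo (0 : ℝ) 1)
    (h : α = 1 - β) (n : ℤ) (x : ↥(sturmianZ α)) :
    sturmianFlip hα hβ h (sturmianShiftBy α n x)
      = sturmianShiftBy β (-n) (sturmianFlip hα hβ h x) := by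
  ext i
  show (!x.1 (-i + n)) = !x.1 (-(i + -n))
  rw [neg_add, neg_neg]

/-! ### The coding measure -/

/-- The point of `Λ_α` coding the orbit of `t`. -/
def sturmianPoint (α t : ℝ) : ↥(sturmianZ α) := ⟨sturmianSeqZ α t, subset_closure ⟨t, rfl⟩⟩

lemma sturmianPoint_add_mul (α t : ℝ) (n : ℤ) :
    sturmianPoint α (t + n * α) = sturmianShiftBy α n (sturmianPoint α t) := by
  ext i
  show sturmianCode α (t + n * α + i * α) = sturmianCode α (t + (↑(i + n) : ℝ) * α)
  congr 1
  push_cast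
  ring

lemma periodic_sturmianPoint (α : ℝ) : Function.Periodic (sturmianPoint α) 1 := by
  intro t
  ext i
  show sturmianCode α (t + 1 + i * α) = sturmianCode α (t + i * α)
  rw [add_right_comm, sturmianCode_add_one]

lemma measurable_sturmianPoint (α : ℝ) : Measurable (sturmianPoint α) := by
  refine Measurable.subtype_mk (measurable_pi_lambda _ fun i => ?_)
  refine measurable_to_bool ?_
  have : (fun t => sturmianSeqZ α t i) ⁻¹' {true} = {t | 1 - α ≤ Int.fract (t + i * α)} := by
    ext t; simp [sturmianSeqZ, sturmianCode]
  rw [this]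
  exact measurableSet_le measurable_const (measurable_fract.comp (measurable_id.add_const _))

/-- The shift-invariant probability measure on `Λ_α` induced by Lebesgue measure on the
circle. -/
def sturmianMeasure (α : ℝ) : Measure ↥(sturmianZ α) :=
  (volume.restrict (Ioc (0 : ℝ) 1)).map (sturmianPoint α)

instance (α : ℝ) : IsProbabilityMeasure (sturmianMeasure α) := by
  have : IsProbabilityMeasure (volume.restrict (Ioc (0 : ℝ) 1)) := ⟨by simp⟩
  exact Measure.isProbabilityMeasure_map (measurable_sturmianPoint α).aemeasurable

lemma sturmianMeasure_real (α : ℝ) {E : Set ↥(sturmianZ α)} (hE : MeasurableSet E) :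
    (sturmianMeasure α).real E
      = ∫ t in (0 : ℝ)..1, E.indicator (1 : ↥(sturmianZ α) → ℝ) (sturmianPoint α t) := by
  rw [sturmianMeasure, map_measureReal_apply (measurable_sturmianPoint α) hE,
    intervalIntegral.integral_of_le zero_le_one,
    ← integral_indicator_one ((measurable_sturmianPoint α) hE)]
  rfl

lemma measurePreserving_shiftBy (α : ℝ) (n : ℤ) :
    MeasurePreserving (sturmianShiftBy α n) (sturmianMeasure α) (sturmianMeasure α) := by
  have hm : Measurable (sturmianShiftBy α n) := (sturmianShiftBy α n).continuous.measurable
  refine ⟨hm, ?_⟩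
  have := Measure.isProbabilityMeasure_map (μ := sturmianMeasure α) hm.aemeasurable
  ext E hE
  rw [← measureReal_eq_measureReal_iff, map_measureReal_apply hm hE,
    sturmianMeasure_real α (hm hE), sturmianMeasure_real α hE]
  set g : ℝ → ℝ := fun t => E.indicator 1 (sturmianPoint α t) with hg
  have hper : Function.Periodic g 1 := fun t => by simp only [hg, periodic_sturmianPoint α t]
  have h1 : ∀ t, (sturmianShiftBy α n ⁻¹' E).indicator (1 : ↥(sturmianZ α) → ℝ) (sturmianPoint α t)
      = g (t + n * α) := fun t => by
    simp only [hg, sturmianPoint_add_mul]; rfl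
  simp only [h1]
  rw [intervalIntegral.integral_comp_add_right]
  have := hper.intervalIntegral_add_eq (n * α) 0
  rw [zero_add, add_comm (n * α) 1] at this
  rw [zero_add, this]

/-- A measurable automorphism moving every point inside its orbit under a countable family of
measure-preserving automorphisms is measure preserving. -/
lemma measurePreserving_of_forall_exists_eq {Y ι : Type*} [MeasurableSpace Y] [MeasurableEq Y]
    [Countable ι] {ν : Measure Y} (S : ι → Y ≃ᵐ Y) (hS : ∀ m, MeasurePreserving (S m) ν ν)
    (f : Y ≃ᵐ Y) (hf : ∀ y, ∃ m, f y = S m y) : MeasurePreserving f ν ν := by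
  refine ⟨f.measurable, Measure.ext fun E hE => ?_⟩
  rw [Measure.map_apply f.measurable hE]
  rcases isEmpty_or_nonempty Y with hY | ⟨⟨y₀⟩⟩
  · rw [Subsingleton.elim (f ⁻¹' E) E]
  have : Nonempty ι := ⟨(hf y₀).choose⟩
  obtain ⟨e, he⟩ := exists_surjective_nat ι
  let D : ℕ → Set Y := disjointed fun k => {y | f y = S (e k) y}
  have hD (k : ℕ) : MeasurableSet (D k) := MeasurableSet.disjointed
    (fun k => measurableSet_eq_fun f.measurable (S (e k)).measurable) k
  have hdisj : Pairwise (Function.onFun Disjoint D) := disjoint_disjointed _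
  have hU : ⋃ k, D k = univ := by
    rw [iUnion_disjointed, eq_univ_iff_forall]
    intro y
    obtain ⟨m, hm⟩ := hf y
    obtain ⟨k, rfl⟩ := he m
    exact mem_iUnion.2 ⟨k, hm⟩
  have hDS {k : ℕ} {y : Y} (hy : y ∈ D k) : f y = S (e k) y := disjointed_subset _ k hy
  have hpiece (k : ℕ) : ν (f ⁻¹' E ∩ D k) = ν (E ∩ f.symm ⁻¹' D k) := by
    rw [← (hS (e k)).measure_preimage (hE.inter (f.symm.measurable (hD k))).nullMeasurableSet]
    congr 1
    ext y
    constructor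
    · rintro ⟨h1, h2⟩
      refine ⟨?_, ?_⟩
      · rw [← hDS h2]; exact h1
      · rw [mem_preimage, ← hDS h2]; simpa using h2
    · rintro ⟨h1, h2⟩
      have h3 := hDS h2
      rw [f.apply_symm_apply] at h3
      have h4 := (S (e k)).injective h3
      rw [mem_preimage, ← h4] at h2
      refine ⟨?_, h2⟩
      rw [mem_preimage, hDS h2]; exact h1
  calc ν (f ⁻¹' E) = ν (⋃ k, f ⁻¹' E ∩ D k) := by rw [← inter_iUnion, hU, inter_univ]
    _ = ∑' k, ν (f ⁻¹' E ∩ D k) := measure_iUnion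
        (fun i j hij => (hdisj hij).mono inter_subset_right inter_subset_right)
        fun k => (f.measurable hE).inter (hD k)
    _ = ∑' k, ν (E ∩ f.symm ⁻¹' D k) := tsum_congr hpiece
    _ = ν (⋃ k, E ∩ f.symm ⁻¹' D k) := (measure_iUnion
        (fun i j hij => ((hdisj hij).preimage _).mono inter_subset_right inter_subset_right)
        fun k => hE.inter (f.symm.measurable (hD k))).symm
    _ = ν E := by rw [← inter_iUnion, ← preimage_iUnion, hU, preimage_univ, inter_univ]

/-- If `f` preserves a probability measure `ν` and intertwines (through `p`) with the shift of
`Λ_α`, then the set of points coded by the symbol `1` has measure `α`. -/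
lemma measureReal_symbol_eq {α : ℝ} (hα : α ∈ Ioo (0 : ℝ) 1) {Y : Type*} [MeasurableSpace Y]
    {ν : Measure Y} [IsProbabilityMeasure ν] {f : Y → Y} (hf : MeasurePreserving f ν ν)
    {p : Y → ↥(sturmianZ α)} (hp : Measurable p)
    (hpf : ∀ y, p (f y) = sturmianShiftBy α 1 (p y)) :
    ν.real {y | (p y).1 0 = true} = α := by
  have hm (i : ℕ) : MeasurableSet {y | (p y).1 i = true} :=
    ((measurable_pi_apply (i : ℤ)).comp (measurable_subtype_coe.comp hp))
      (measurableSet_singleton true)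
  have hc (i : ℕ) : ν.real {y | (p y).1 i = true} = ν.real {y | (p y).1 0 = true} := by
    induction i with
    | zero => rfl
    | succ i ih =>
      rw [← ih, ← hf.measureReal_preimage (hm i).nullMeasurableSet]
      congr 1
      ext y
      simp [hpf]
  set c := ν.real {y | (p y).1 0 = true} with hcdef
  have hite (i : ℕ) : {y | (p y).1 i = true}.indicator (fun _ => (1 : ℝ))
      = fun y => if (p y).1 i = true then (1 : ℝ) else 0 := by
    ext y
    simp [indicator_apply]
  have hint (i : ℕ) : Integrable (fun y => if (p y).1 i = true then (1 : ℝ) else 0) ν :=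
    (hite i) ▸ (integrable_indicator_iff (hm i)).2 (integrable_const (1 : ℝ)).integrableOn
  have hval (i : ℕ) : ∫ y, (if (p y).1 i = true then (1 : ℝ) else 0) ∂ν = c := by
    rw [← hc i, ← integral_indicator_one (hm i), ← hite i]
    rfl
  have hbound (N : ℕ) : |N * c - N * α| ≤ 1 := by
    have hsum : ∫ y, (∑ i ∈ Finset.range N, (if (p y).1 i = true then 1 else 0 : ℝ) - N * α) ∂ν
        = N * c - N * α := by
      rw [integral_sub (integrable_finsetSum _ fun i _ => hint i) (integrable_const _),
        integral_finsetSum _ fun i _ => hint i]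
      simp [hval]
    rw [← hsum]
    have := norm_integral_le_of_norm_le_const (μ := ν) (C := 1)
      (f := fun y => ∑ i ∈ Finset.range N, (if (p y).1 i = true then 1 else 0 : ℝ) - N * α)
      (Filter.Eventually.of_forall fun y => sturmianZ_balanced hα (p y).2 N)
    simpa using this
  by_contra hne
  have hpos : 0 < |c - α| := abs_pos.2 (sub_ne_zero.2 hne)
  obtain ⟨N, hN⟩ := exists_nat_gt (1 / |c - α|)
  have h1 := hbound N
  rw [← mul_sub, abs_mul, Nat.abs_cast] at h1
  rw [div_lt_iff₀ hpos] at hN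
  linarith

/-! ### Measures of clopen sets -/

/-- Indicator functions of the intervals `[c, 1)` with `c ∈ (ℤ + αℤ) ∩ [0, 1]`, which form a
semigroup under multiplication. -/
def stepSubsemigroup (α : ℝ) : Subsemigroup (ℝ → ℝ) where
  carrier := {f | ∃ c ∈ ZplusAZ α, c ∈ Icc (0 : ℝ) 1 ∧ f = (Ico c 1).indicator 1}
  mul_mem' := by
    rintro _ _ ⟨c, hc, hc', rfl⟩ ⟨d, hd, hd', rfl⟩
    refine ⟨max c d, ?_, ⟨le_max_of_le_left hc'.1, max_le hc'.2 hd'.2⟩, ?_⟩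
    · rcases max_choice c d with h | h <;> rw [h] <;> assumption
    · ext t
      rw [← min_self (1 : ℝ), ← Ico_inter_Ico, inter_indicator_one]
      simp

/-- The ring of integer-valued step functions on `[0, 1)` with jumps in `ℤ + αℤ`. -/
def stepRing (α : ℝ) : NonUnitalSubring (ℝ → ℝ) := NonUnitalSubring.closure (stepSubsemigroup α)

lemma indicator_mem_stepRing {α c : ℝ} (hc : c ∈ ZplusAZ α) (hc' : c ∈ Icc (0 : ℝ) 1) :
    (Ico c 1).indicator 1 ∈ stepRing α :=
  NonUnitalSubring.subset_closure ⟨c, hc, hc', rfl⟩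

lemma integral_stepRing {α : ℝ} {f : ℝ → ℝ} (hf : f ∈ stepRing α) :
    Integrable f ∧ ∫ t, f t ∈ ZplusAZ α := by
  rw [stepRing, NonUnitalSubring.mem_closure_iff, Subsemigroup.closure_eq] at hf
  induction hf using AddSubgroup.closure_induction with
  | mem f hf =>
    obtain ⟨c, hc, hc', rfl⟩ := hf
    refine ⟨(integrable_indicator_iff measurableSet_Ico).2 (by simp [IntegrableOn, Pi.one_def]), ?_⟩
    rw [integral_indicator_one measurableSet_Ico, Real.volume_real_Ico_of_le hc'.2]
    exact sub_mem (one_mem_ZplusAZ α) hc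
  | zero => simp
  | add f g _ _ hf hg =>
    refine ⟨hf.1.add hg.1, ?_⟩
    have := integral_add hf.1 hg.1
    simp only [Pi.add_apply, this]
    exact add_mem hf.2 hg.2
  | neg f _ hf =>
    refine ⟨hf.1.neg, ?_⟩
    simp only [Pi.neg_apply, integral_neg]
    exact neg_mem hf.2

lemma one_sub_fract_mem {α a : ℝ} (ha : a ∈ ZplusAZ α) : 1 - Int.fract a ∈ ZplusAZ α :=
  sub_mem (one_mem_ZplusAZ α) (sub_mem ha ⟨⌊a⌋, 0, by simp⟩)

/-- The function on `[0, 1)` indicating that the coding of `t` lies in `E`. -/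
def codingIndicator (α : ℝ) (E : Set ↥(sturmianZ α)) : ℝ → ℝ :=
  (sturmianPoint α ⁻¹' E ∩ Ico 0 1).indicator 1

lemma codingIndicator_univ_mem (α : ℝ) : codingIndicator α univ ∈ stepRing α := by
  rw [codingIndicator, preimage_univ, univ_inter]
  exact indicator_mem_stepRing (zero_mem (ZplusAZ α)) ⟨le_rfl, zero_le_one⟩

lemma codingIndicator_compl_mem {α : ℝ} {E : Set ↥(sturmianZ α)}
    (hE : codingIndicator α E ∈ stepRing α) : codingIndicator α Eᶜ ∈ stepRing α := by
  have : codingIndicator α Eᶜ = codingIndicator α univ - codingIndicator α E := by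
    ext t
    by_cases h1 : sturmianPoint α t ∈ E <;> by_cases h2 : t ∈ Ico (0 : ℝ) 1 <;>
      simp [codingIndicator, indicator, h1, h2]
  rw [this]
  exact sub_mem (codingIndicator_univ_mem α) hE

lemma codingIndicator_inter_mem {α : ℝ} {E F : Set ↥(sturmianZ α)}
    (hE : codingIndicator α E ∈ stepRing α) (hF : codingIndicator α F ∈ stepRing α) :
    codingIndicator α (E ∩ F) ∈ stepRing α := by
  have : codingIndicator α (E ∩ F) = codingIndicator α E * codingIndicator α F := by
    rw [codingIndicator, codingIndicator, codingIndicator, ← inter_indicator_one, preimage_inter,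
      inter_inter_distrib_right]
  rw [this]
  exact mul_mem hE hF

lemma codingIndicator_union_mem {α : ℝ} {E F : Set ↥(sturmianZ α)}
    (hE : codingIndicator α E ∈ stepRing α) (hF : codingIndicator α F ∈ stepRing α) :
    codingIndicator α (E ∪ F) ∈ stepRing α := by
  rw [← compl_compl (E ∪ F), compl_union]
  exact codingIndicator_compl_mem
    (codingIndicator_inter_mem (codingIndicator_compl_mem hE) (codingIndicator_compl_mem hF))

lemma codingIndicator_symbol_mem {α : ℝ} (hα : α ∈ Ioo (0 : ℝ) 1) (i : ℤ) (b : Bool) :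
    codingIndicator α {x | x.1 i = b} ∈ stepRing α := by
  have htrue : codingIndicator α {x | x.1 i = true} ∈ stepRing α := by
    have key : codingIndicator α {x | x.1 i = true}
        = (⌊(↑(i + 1) : ℝ) * α⌋ - ⌊(i : ℝ) * α⌋ : ℤ) • codingIndicator α univ
          + ((Ico (1 - Int.fract ((↑(i + 1) : ℝ) * α)) 1).indicator 1
            - (Ico (1 - Int.fract ((i : ℝ) * α)) 1).indicator 1) := by
      ext t
      by_cases ht : t ∈ Ico (0 : ℝ) 1
      · have h1 := congrArg (Int.cast (R := ℝ)) (sturmianCode_eq_floor hα (t + i * α))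
        rw [show t + i * α + α = t + (↑(i + 1) : ℝ) * α by push_cast; ring, Int.cast_sub,
          floor_add_of_mem_Ico ht, floor_add_of_mem_Ico ht] at h1
        have h2 : codingIndicator α univ t = 1 := by simp [codingIndicator, indicator, ht.1, ht.2]
        have h3 : codingIndicator α {x | x.1 i = true} t
            = ((if sturmianCode α (t + i * α) = true then 1 else 0 : ℤ) : ℝ) := by
          simp [codingIndicator, indicator, ht.1, ht.2, sturmianPoint, sturmianSeqZ]
        simp only [Pi.add_apply, Pi.sub_apply, Pi.smul_apply, h2, h3, h1]
        rw [zsmul_eq_mul, Int.cast_sub, mul_one, add_sub_add_comm]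
      · have hf (a : ℝ) : (Ico (1 - Int.fract a) 1).indicator (1 : ℝ → ℝ) t = 0 :=
          indicator_of_notMem
            (fun h => ht ⟨by linarith [h.1, Int.fract_lt_one a], h.2⟩) _
        have hg (E : Set ↥(sturmianZ α)) : codingIndicator α E t = 0 :=
          indicator_of_notMem (fun h => ht h.2) _
        simp only [Pi.add_apply, Pi.sub_apply, Pi.smul_apply, hf, hg, smul_zero, sub_zero,
          add_zero]
    have hmem (j : ℤ) :
        (Ico (1 - Int.fract ((j : ℝ) * α)) 1).indicator (1 : ℝ → ℝ) ∈ stepRing α :=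
      indicator_mem_stepRing (one_sub_fract_mem ⟨0, j, by simp⟩)
        ⟨by linarith [Int.fract_lt_one ((j : ℝ) * α)], by linarith [Int.fract_nonneg ((j : ℝ) * α)]⟩
    rw [key]
    exact add_mem (zsmul_mem (codingIndicator_univ_mem α) _) (sub_mem (hmem _) (hmem _))
  cases b with
  | true => exact htrue
  | false =>
    convert codingIndicator_compl_mem htrue using 2
    ext x
    simp

lemma codingIndicator_clopen_mem {α : ℝ} (hα : α ∈ Ioo (0 : ℝ) 1) {E : Set ↥(sturmianZ α)}
    (hE : IsClopen E) : codingIndicator α E ∈ stepRing α := by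
  have : CompactSpace ↥(sturmianZ α) := isCompact_iff_compactSpace.1 isClosed_closure.isCompact
  have hempty : codingIndicator α ∅ ∈ stepRing α := by
    rw [← compl_univ]
    exact codingIndicator_compl_mem (codingIndicator_univ_mem α)
  obtain ⟨F, hEF, hFE, hF⟩ : ∃ F, E ⊆ F ∧ F ⊆ E ∧ codingIndicator α F ∈ stepRing α := by
    refine hE.isClosed.isCompact.induction_on
      (p := fun s => ∃ F, s ⊆ F ∧ F ⊆ E ∧ codingIndicator α F ∈ stepRing α) ?_ ?_ ?_ ?_
    · exact ⟨∅, subset_rfl, empty_subset _, hempty⟩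
    · rintro s t hst ⟨F, h1, h2⟩
      exact ⟨F, hst.trans h1, h2⟩
    · rintro s t ⟨F, h1, h2, h3⟩ ⟨G, h4, h5, h6⟩
      exact ⟨F ∪ G, union_subset_union h1 h4, union_subset h2 h5, codingIndicator_union_mem h3 h6⟩
    · intro x hx
      obtain ⟨V, hV, hVE⟩ := mem_nhds_subtype _ _ _ |>.1 (hE.isOpen.mem_nhds hx)
      rw [nhds_pi, Filter.mem_pi] at hV
      obtain ⟨I, hI, u, hu, hIu⟩ := hV
      have hcyl : ∀ J : Set ℤ, J.Finite →
          IsOpen (⋂ i ∈ J, {y : ↥(sturmianZ α) | y.1 i = x.1 i}) ∧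
          codingIndicator α (⋂ i ∈ J, {y | y.1 i = x.1 i}) ∈ stepRing α := by
        intro J hJ
        induction J, hJ using Set.Finite.induction_on with
        | empty => simpa using codingIndicator_univ_mem α
        | @insert j J _ _ ih =>
          rw [biInter_insert]
          refine ⟨IsOpen.inter ?_ ih.1,
            codingIndicator_inter_mem (codingIndicator_symbol_mem hα _ _) ih.2⟩
          exact (isOpen_discrete {x.1 j}).preimage (continuous_sturmianZ_apply α j)
      refine ⟨_, mem_nhdsWithin_of_mem_nhds ((hcyl I hI).1.mem_nhds (by simp)), _, subset_rfl,
        fun y hy => hVE (hIu fun i hi => ?_), (hcyl I hI).2⟩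
      rw [show y.1 i = x.1 i from mem_iInter₂.1 hy i hi]
      exact mem_of_mem_nhds (hu i)
  rwa [hEF.antisymm hFE]

/-- The measure of a clopen subset of `Λ_α` lies in `ℤ + αℤ`. -/
lemma sturmianMeasure_clopen_mem {α : ℝ} (hα : α ∈ Ioo (0 : ℝ) 1) {E : Set ↥(sturmianZ α)}
    (hE : IsClopen E) : (sturmianMeasure α).real E ∈ ZplusAZ α := by
  have h := (integral_stepRing (codingIndicator_clopen_mem hα hE)).2
  have hm : MeasurableSet (sturmianPoint α ⁻¹' E) := measurable_sturmianPoint α hE.isOpen.measurableSet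
  rw [codingIndicator, integral_indicator_one (hm.inter measurableSet_Ico)] at h
  rwa [sturmianMeasure, map_measureReal_apply (measurable_sturmianPoint α) hE.isOpen.measurableSet,
    ← restrict_Ico_eq_restrict_Ioc, measureReal_restrict_apply hm]

/-! ### Orbit equivalence -/

lemma mem_ZplusAZ_of_orbit_map {α β : ℝ} (hα : α ∈ Ioo (0 : ℝ) 1) (hβ : β ∈ Ioo (0 : ℝ) 1)
    (h : ↥(sturmianZ α) ≃ₜ ↥(sturmianZ β))
    (hh : ∀ x, ∃ n, h (sturmianShiftBy α 1 x) = sturmianShiftBy β n (h x)) :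
    α ∈ ZplusAZ β := by
  let f : ↥(sturmianZ β) ≃ₜ ↥(sturmianZ β) := (h.symm.trans (sturmianShiftBy α 1)).trans h
  have hf : MeasurePreserving f (sturmianMeasure β) (sturmianMeasure β) :=
    measurePreserving_of_forall_exists_eq (fun n => (sturmianShiftBy β n).toMeasurableEquiv)
      (measurePreserving_shiftBy β) f.toMeasurableEquiv fun y => by
        obtain ⟨n, hn⟩ := hh (h.symm y)
        exact ⟨n, hn.trans (by simp)⟩
  have hval := measureReal_symbol_eq hα hf h.symm.continuous.measurable (by simp [f])
  rw [← hval]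
  refine sturmianMeasure_clopen_mem hβ ?_
  exact (isClopen_discrete {true}).preimage
    ((continuous_sturmianZ_apply α 0).comp h.symm.continuous)

lemma eq_or_eq_one_sub_of_mem_ZplusAZ {α β : ℝ} (hα : Irrational α) (hαm : α ∈ Ioo (0 : ℝ) 1)
    (hβm : β ∈ Ioo (0 : ℝ) 1) (h1 : α ∈ ZplusAZ β) (h2 : β ∈ ZplusAZ α) :
    α = β ∨ α = 1 - β := by
  obtain ⟨a, b, hab⟩ := h1
  obtain ⟨c, d, hcd⟩ := h2
  have hbd : b * d = 1 := by
    by_contra hne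
    have hne' : (1 - b * d : ℤ) ≠ 0 := fun h => hne (by linarith)
    have hmul : ((1 - b * d : ℤ) : ℝ) * α = ((a + b * c : ℤ) : ℝ) := by
      push_cast
      rw [hcd] at hab
      linear_combination hab
    exact (hα.intCast_mul hne').ne_int _ hmul
  rcases Int.eq_one_or_neg_one_of_mul_eq_one hbd with rfl | rfl
  · left
    have h3 : (a : ℝ) < 1 := by push_cast at hab; linarith [hαm.2, hβm.1]
    have h4 : (-1 : ℝ) < a := by push_cast at hab; linarith [hαm.1, hβm.2]
    have : a = 0 := by
      have h3' : a < 1 := by exact_mod_cast h3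
      have h4' : -1 < a := by exact_mod_cast h4
      omega
    simpa [this] using hab
  · right
    have h3 : (a : ℝ) < 2 := by push_cast at hab; linarith [hαm.2, hβm.2]
    have h4 : (0 : ℝ) < a := by push_cast at hab; linarith [hαm.1, hβm.1]
    have : a = 1 := by
      have h3' : a < 2 := by exact_mod_cast h3
      have h4' : 0 < a := by exact_mod_cast h4
      omega
    rw [hab, this]
    push_cast
    ring

/-- Two two-sided Sturmian subshifts `(Λ_α, σ_α)` and `(Λ_β, σ_β)` are orbit
equivalent (there is a homeomorphism mapping the orbit of each `x` onto the orbit of `h x`)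
if and only if `α = β` or `α = 1 - β`. -/
theorem sturmian_orbit_equivalence_iff (α β : ℝ) (hα : Irrational α) (hβ : Irrational β)
    (hαm : α ∈ Set.Ioo (0 : ℝ) 1) (hβm : β ∈ Set.Ioo (0 : ℝ) 1) :
    (∃ h : ↥(sturmianZ α) ≃ₜ ↥(sturmianZ β),
        ∀ x : ↥(sturmianZ α),
          ⇑h '' {y : ↥(sturmianZ α) | (y : ℤ → Bool) ∈ orbitZ (x : ℤ → Bool)}
            = {z : ↥(sturmianZ β) | (z : ℤ → Bool) ∈ orbitZ ((h x : ℤ → Bool))})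
      ↔ (α = β ∨ α = 1 - β) := by
  have horb {γ : ℝ} (x : ↥(sturmianZ γ)) :
      {y : ↥(sturmianZ γ) | y.1 ∈ orbitZ x.1} = range fun n => sturmianShiftBy γ n x := by
    ext y
    simp only [mem_ofPred_eq, mem_orbitZ_iff, mem_range, eq_comm]
  simp only [horb]
  constructor
  · rintro ⟨h, hh⟩
    refine eq_or_eq_one_sub_of_mem_ZplusAZ hα hαm hβm
      (mem_ZplusAZ_of_orbit_map hαm hβm h fun x => ?_)
      (mem_ZplusAZ_of_orbit_map hβm hαm h.symm fun z => ?_)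
    · obtain ⟨n, hn⟩ := (hh x).subset (mem_image_of_mem h (mem_range_self 1))
      exact ⟨n, hn.symm⟩
    · obtain ⟨_, ⟨n, rfl⟩, hn⟩ := (hh (h.symm z)).superset (mem_range_self 1)
      refine ⟨n, ?_⟩
      rw [h.apply_symm_apply] at hn
      rw [← hn, h.symm_apply_apply]
  · rintro (rfl | hαβ)
    · exact ⟨Homeomorph.refl _, fun x => image_id _⟩
    · refine ⟨sturmianFlip hαm hβm hαβ, fun x => ?_⟩
      rw [← range_comp]
      simp only [Function.comp_def, sturmianFlip_shiftBy]
      exact (Equiv.neg ℤ).surjective.range_comp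
        fun n => sturmianShiftBy β n (sturmianFlip hαm hβm hαβ x)

end
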